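/- Let D be a commutative dga over ℤ_p whose homology and Massey products agree with those of C, with chosen order-p classes α_m as in that definition. Suppose ā ∈ D_{1-2p} and b̄ ∈ D_{2-2p} satisfy d(ā) = 0, α_{-1} = [ā], and d(b̄) = -p·ā. Then for every integer i ≥ 1: d(b̄^i) = -i·p·ā·b̄^{i-1}; the element ā·b̄^{i-1} is a cycle; α_{-i} = [i·ā·b̄^{i-1}] in H_{-(2p-2)i-1}(D); and the homology class [ā·b̄^{i-1}] generates the cyclic ℤ_p-module H_{-(2p-2)i-1}(D) ≅ ℤ_p/ipℤ_p. -/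

import Mathlib

set_option synthInstance.maxHeartbeats 1000000
set_option maxHeartbeats 1000000

/-!
Statement 13: the nonpositive part of the main computation.
-/

noncomputable section

/-- A (graded-commutative) differential graded algebra over the `p`-adic integers,
presented via an internal grading: a `ℤ_[p]`-algebra `A` together with a family of
submodules `grading n` (`n : ℤ`) forming an internal direct sum decomposition
`A = ⊕ₙ Aₙ`, compatible with the multiplication, graded-commutative, and equipped
with a square-zero differential of degree `-1` satisfying the graded Leibniz rule. -/
structure DGA (p : ℕ) [Fact p.Prime] where
  A : Type
  [ringA : Ring A]
  [algA : Algebra ℤ_[p] A]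
  grading : ℤ → Submodule ℤ_[p] A
  one_mem : (1 : A) ∈ grading 0
  mul_mem : ∀ {i j : ℤ} {a b : A}, a ∈ grading i → b ∈ grading j → a * b ∈ grading (i + j)
  isInternal : DirectSum.IsInternal grading
  comm : ∀ {i j : ℤ} {a b : A}, a ∈ grading i → b ∈ grading j →
    a * b = (((-1 : ℤˣ) ^ (i * j) : ℤˣ) : ℤ) • (b * a)
  d : A →ₗ[ℤ_[p]] A
  d_mem : ∀ {n : ℤ} {a : A}, a ∈ grading n → d a ∈ grading (n - 1)
  d_sq : ∀ a : A, d (d a) = 0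
  leibniz : ∀ {i : ℤ} {a : A}, a ∈ grading i → ∀ b : A,
    d (a * b) = d a * b + (((-1 : ℤˣ) ^ i : ℤˣ) : ℤ) • (a * d b)

attribute [instance] DGA.ringA DGA.algA

namespace DGA

variable {p : ℕ} [Fact p.Prime]

/-- The `n`-cycles of a dga: elements of degree `n` killed by the differential. -/
def cycles (X : DGA p) (n : ℤ) : Submodule ℤ_[p] X.A :=
  X.grading n ⊓ LinearMap.ker X.d

/-- The `n`-boundaries of a dga: images under `d` of elements of degree `n + 1`. -/
def boundaries (X : DGA p) (n : ℤ) : Submodule ℤ_[p] X.A :=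
  (X.grading (n + 1)).map X.d

/-- The `n`-th homology `H_n = ker(d : A_n → A_(n-1)) / im(d : A_(n+1) → A_n)` of a dga. -/
abbrev H (X : DGA p) (n : ℤ) : Type :=
  X.cycles n ⧸ ((X.boundaries n).comap (X.cycles n).subtype)

/-- The homology class of a cycle. -/
def cls (X : DGA p) {n : ℤ} (a : X.A) (h : a ∈ X.cycles n) : X.H n :=
  Submodule.Quotient.mk ⟨a, h⟩

end DGA

/-- The Massey product relation `⟨α_i, p, α_j⟩ = {α_(i+j)}` (with zero indeterminacy)
inside a dga `D`, for a family of homology classes `α_m ∈ H_((2p-2)m-1)(D)`: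
for all cycles `a`, `c` representing `α_i`, `α_j`, there exist `u ∈ D_((2p-2)i)` with
`d(u) = p·a` and `v ∈ D_((2p-2)j)` with `d(v) = -p·c`, and for all such `u`, `v` the
element `-u·c + a·v` is a cycle representing `α_(i+j)`. -/
def MasseyRel (p : ℕ) [Fact p.Prime] (D : DGA p)
    (α : (m : ℤ) → D.H ((2 * (p : ℤ) - 2) * m - 1)) (i j : ℤ) : Prop :=
  ∀ (a : D.A) (ha : a ∈ D.cycles ((2 * (p : ℤ) - 2) * i - 1)), D.cls a ha = α i →
  ∀ (c : D.A) (hc : c ∈ D.cycles ((2 * (p : ℤ) - 2) * j - 1)), D.cls c hc = α j →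
    (∃ u ∈ D.grading ((2 * (p : ℤ) - 2) * i), D.d u = (p : ℤ_[p]) • a) ∧
    (∃ v ∈ D.grading ((2 * (p : ℤ) - 2) * j), D.d v = -((p : ℤ_[p]) • c)) ∧
    (∀ u ∈ D.grading ((2 * (p : ℤ) - 2) * i), ∀ v ∈ D.grading ((2 * (p : ℤ) - 2) * j),
      D.d u = (p : ℤ_[p]) • a → D.d v = -((p : ℤ_[p]) • c) →
      ∃ h : -(u * c) + a * v ∈ D.cycles ((2 * (p : ℤ) - 2) * (i + j) - 1),
        D.cls _ h = α (i + j))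

/-- The homology of `D` agrees with that of `C` (equivalently, with `π_*` of the
`K(1)`-local sphere): `H_0 ≅ ℤ_p`, `H_(-1) ≅ ℤ_p`, `H_((2p-2)m-1) ≅ ℤ_p/mpℤ_p` for
`m ≠ 0`, and all other homology groups vanish. -/
def HomologyAgreesWithC (p : ℕ) [Fact p.Prime] (D : DGA p) : Prop :=
  Nonempty (D.H 0 ≃ₗ[ℤ_[p]] ℤ_[p]) ∧
  Nonempty (D.H (-1) ≃ₗ[ℤ_[p]] ℤ_[p]) ∧
  (∀ m : ℤ, m ≠ 0 →
    Nonempty (D.H ((2 * (p : ℤ) - 2) * m - 1) ≃ₗ[ℤ_[p]]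
      (ℤ_[p] ⧸ Ideal.span {(m : ℤ_[p]) * (p : ℤ_[p])}))) ∧
  (∀ n : ℤ, n ≠ 0 → (¬ ∃ m : ℤ, n = (2 * (p : ℤ) - 2) * m - 1) → Subsingleton (D.H n))

/-- The Massey products of `D` agree with those of `C` (equivalently, with the Toda
brackets of the `K(1)`-local sphere): there are classes `α_m ∈ H_((2p-2)m-1)(D)` of
additive order exactly `p` (for `m ≠ 0`, with `α_0 = 0`) satisfying
`⟨α_i, p, α_j⟩ = {α_(i+j)}` for all nonzero `i`, `j`. -/
def MasseyAgreesWithC (p : ℕ) [Fact p.Prime] (D : DGA p) : Prop :=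
  ∃ α : (m : ℤ) → D.H ((2 * (p : ℤ) - 2) * m - 1),
    α 0 = 0 ∧
    (∀ m : ℤ, m ≠ 0 → α m ≠ 0 ∧ (p : ℤ_[p]) • α m = 0) ∧
    (∀ i : ℤ, i ≠ 0 → ∀ j : ℤ, j ≠ 0 → MasseyRel p D α i j)

/-- The homology and Massey products of `D` agree with those of `C`. -/
def AgreesWithC (p : ℕ) [Fact p.Prime] (D : DGA p) : Prop :=
  HomologyAgreesWithC p D ∧ MasseyAgreesWithC p D


namespace DGA

variable {p : ℕ} [Fact p.Prime]

theorem mul_comm_of_even (X : DGA p) {i j : ℤ} (h : Even (i * j)) {a b : X.A}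
    (ha : a ∈ X.grading i) (hb : b ∈ X.grading j) : a * b = b * a := by
  rw [X.comm ha hb, h.neg_one_zpow]
  simp

theorem mul_self_eq_zero_of_odd (X : DGA p) (hp : Odd p) {i : ℤ} (hi : Odd i) {a : X.A}
    (ha : a ∈ X.grading i) : a * a = 0 := by
  have h := X.comm ha ha
  rw [(hi.mul hi).neg_one_zpow] at h
  have h2 : (2 : ℤ_[p]) • (a * a) = 0 := by
    rw [two_smul]
    nth_rewrite 1 [h]
    simp
  have hu : IsUnit (2 : ℤ_[p]) := by
    have hc : Nat.Coprime p 2 := Nat.coprime_two_right.mpr hp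
    simpa using (PadicInt.isUnit_iff (p := p) (z := ((2 : ℕ) : ℤ_[p]))).mpr
      (PadicInt.norm_natCast_eq_one_iff.mpr hc)
  exact hu.smul_eq_zero.mp h2

theorem pow_mem (X : DGA p) {k : ℤ} {b : X.A} (hb : b ∈ X.grading k) (n : ℕ) :
    b ^ n ∈ X.grading (k * n) := by
  induction n with
  | zero => simpa using X.one_mem
  | succ n ih =>
    rw [pow_succ]
    convert X.mul_mem ih hb using 2
    push_cast
    ring

theorem d_one (X : DGA p) : X.d 1 = 0 := by
  simpa using X.leibniz X.one_mem 1

theorem d_pow_succ (X : DGA p) {k : ℤ} (hk : Even k) {a b : X.A} (hb : b ∈ X.grading k)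
    (hab : b * a = a * b) {r : ℤ_[p]} (hdb : X.d b = -(r • a)) (n : ℕ) :
    X.d (b ^ (n + 1)) = -((((n + 1 : ℕ) : ℤ_[p]) * r) • (a * b ^ n)) := by
  induction n with
  | zero => simp [hdb]
  | succ n ih =>
    rw [pow_succ' b (n + 1), X.leibniz hb, hk.neg_one_zpow, hdb, ih]
    have : b * (a * b ^ n) = a * b ^ (n + 1) := by
      rw [← mul_assoc, hab, mul_assoc, ← pow_succ']
    simp only [Units.val_one, one_smul, neg_mul, mul_neg, smul_mul_assoc, mul_smul_comm, this]
    rw [← neg_add, ← add_smul]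
    congr 2
    push_cast
    ring

theorem d_mul_pow_eq_zero (X : DGA p) {k l : ℤ} (hk : Even k) {a b : X.A}
    (ha : a ∈ X.grading l) (hb : b ∈ X.grading k) (hab : b * a = a * b) (haa : a * a = 0)
    (hda : X.d a = 0) {r : ℤ_[p]} (hdb : X.d b = -(r • a)) (n : ℕ) :
    X.d (a * b ^ n) = 0 := by
  rw [X.leibniz ha, hda, zero_mul, zero_add]
  cases n with
  | zero => simp [X.d_one]
  | succ n =>
    rw [X.d_pow_succ hk hb hab hdb, mul_neg, mul_smul_comm, ← mul_assoc, haa]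
    simp

theorem cls_smul (X : DGA p) {n : ℤ} (r : ℤ_[p]) {a : X.A} (h : a ∈ X.cycles n)
    (h' : r • a ∈ X.cycles n) : X.cls (r • a) h' = r • X.cls a h :=
  rfl

end DGA

/-- In a module isomorphic to `ℤ_p/(rp)`, an element not killed by `r` is a generator. -/
theorem PadicInt.span_singleton_eq_top_of_smul_ne_zero {p : ℕ} [Fact p.Prime] {M : Type*}
    [AddCommGroup M] [Module ℤ_[p] M] {r : ℤ_[p]}
    (e : M ≃ₗ[ℤ_[p]] (ℤ_[p] ⧸ Ideal.span {r * (p : ℤ_[p])})) {x : M} (hx : r • x ≠ 0) :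
    Submodule.span ℤ_[p] {x} = ⊤ := by
  obtain ⟨y, hy⟩ := Ideal.Quotient.mk_surjective (e x)
  have hu : IsUnit y := by
    by_contra hn
    have hmem : y ∈ IsLocalRing.maximalIdeal ℤ_[p] := (IsLocalRing.mem_maximalIdeal y).mpr hn
    rw [PadicInt.maximalIdeal_eq_span_p, Ideal.mem_span_singleton] at hmem
    apply hx
    apply e.injective
    rw [map_smul, map_zero, ← hy]
    change Ideal.Quotient.mk _ (r * y) = 0
    rw [Ideal.Quotient.eq_zero_iff_mem, Ideal.mem_span_singleton]
    exact mul_dvd_mul_left r hmem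
  obtain ⟨u, rfl⟩ := hu
  rw [eq_top_iff]
  rintro m -
  obtain ⟨z, hz⟩ := Ideal.Quotient.mk_surjective (e m)
  rw [Submodule.mem_span_singleton]
  refine ⟨z * ↑u⁻¹, e.injective ?_⟩
  rw [map_smul, ← hy, ← hz]
  change Ideal.Quotient.mk _ (z * ↑u⁻¹ * ↑u) = _
  rw [Units.inv_mul_cancel_right]

/-- The nonpositive part of the main computation: with `α_(-1) = [ā]`, `d(ā) = 0` and
`d(b̄) = -p·ā`, one has `d(b̄ⁱ) = -i·p·ā·b̄^(i-1)`, the element `ā·b̄^(i-1)` is a cycle,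
`α_(-i) = [i·ā·b̄^(i-1)]`, and `[ā·b̄^(i-1)]` generates the cyclic `ℤ_[p]`-module
`H_(-(2p-2)i-1)(D) ≅ ℤ_p/ipℤ_p`, for every `i ≥ 1`. -/
theorem nonpositive_part (p : ℕ) [Fact p.Prime] (hp : Odd p) (D : DGA p)
    (hH : HomologyAgreesWithC p D)
    (α : (m : ℤ) → D.H ((2 * (p : ℤ) - 2) * m - 1))
    (hα0 : α 0 = 0)
    (hord : ∀ m : ℤ, m ≠ 0 → α m ≠ 0 ∧ (p : ℤ_[p]) • α m = 0)
    (hrel : ∀ i : ℤ, i ≠ 0 → ∀ j : ℤ, j ≠ 0 → MasseyRel p D α i j)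
    (abar bbar : D.A)
    (habar : abar ∈ D.grading ((2 * (p : ℤ) - 2) * (-1) - 1))
    (hbbar : bbar ∈ D.grading ((2 * (p : ℤ) - 2) * (-1)))
    (hdabar : D.d abar = 0) (hdbbar : D.d bbar = -((p : ℤ_[p]) • abar))
    (hαm1 : ∃ h : abar ∈ D.cycles ((2 * (p : ℤ) - 2) * (-1) - 1), D.cls abar h = α (-1)) :
    ∀ i : ℕ, 1 ≤ i →
      D.d (bbar ^ i) = -(((i : ℤ_[p]) * (p : ℤ_[p])) • (abar * bbar ^ (i - 1))) ∧
      ∃ h : abar * bbar ^ (i - 1) ∈ D.cycles ((2 * (p : ℤ) - 2) * (-(i : ℤ)) - 1),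
        (∃ h' : (i : ℤ_[p]) • (abar * bbar ^ (i - 1))
              ∈ D.cycles ((2 * (p : ℤ) - 2) * (-(i : ℤ)) - 1),
          D.cls _ h' = α (-(i : ℤ))) ∧
        Submodule.span ℤ_[p] {D.cls (abar * bbar ^ (i - 1)) h} = ⊤ ∧
        Nonempty (D.H ((2 * (p : ℤ) - 2) * (-(i : ℤ)) - 1) ≃ₗ[ℤ_[p]]
          (ℤ_[p] ⧸ Ideal.span {(i : ℤ_[p]) * (p : ℤ_[p])})) := by
  have hk : Even ((2 * (p : ℤ) - 2) * (-1)) := ⟨-((p : ℤ) - 1), by ring⟩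
  have hl : Odd ((2 * (p : ℤ) - 2) * (-1) - 1) := hk.sub_odd odd_one
  have hab : bbar * abar = abar * bbar := D.mul_comm_of_even (hk.mul_right _) hbbar habar
  have haa : abar * abar = 0 := D.mul_self_eq_zero_of_odd hp hl habar
  have hpow (n : ℕ) : bbar ^ n ∈ D.grading ((2 * (p : ℤ) - 2) * (-(n : ℤ))) := by
    convert D.pow_mem hbbar n using 2
    ring
  have hcyc (n : ℕ) :
      abar * bbar ^ n ∈ D.cycles ((2 * (p : ℤ) - 2) * (-((n + 1 : ℕ) : ℤ)) - 1) := by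
    refine ⟨?_, D.d_mul_pow_eq_zero hk habar hbbar hab haa hdabar hdbbar n⟩
    have hdeg : (2 * (p : ℤ) - 2) * (-((n + 1 : ℕ) : ℤ)) - 1
        = (2 * (p : ℤ) - 2) * (-1) - 1 + (2 * (p : ℤ) - 2) * (-(n : ℤ)) := by
      push_cast
      ring
    rw [hdeg]
    exact D.mul_mem habar (hpow n)
  have hcls (n : ℕ) : ∃ h' : ((n + 1 : ℕ) : ℤ_[p]) • (abar * bbar ^ n)
      ∈ D.cycles ((2 * (p : ℤ) - 2) * (-((n + 1 : ℕ) : ℤ)) - 1),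
      D.cls _ h' = α (-((n + 1 : ℕ) : ℤ)) := by
    induction n with
    | zero => simpa using hαm1
    | succ n ih =>
      obtain ⟨ha, hαa⟩ := hαm1
      obtain ⟨hc, hαc⟩ := ih
      have hmassey := (hrel (-1) (by decide) (-((n + 1 : ℕ) : ℤ)) (by simp; omega)
        abar ha hαa _ hc hαc).2.2 (-bbar) (neg_mem hbbar) (bbar ^ (n + 1)) (hpow (n + 1))
        (by rw [map_neg, hdbbar, neg_neg])
        (by rw [D.d_pow_succ hk hbbar hab hdbbar, smul_smul, mul_comm])
      have hdeg : (-1 : ℤ) + -((n + 1 : ℕ) : ℤ) = -((n + 1 + 1 : ℕ) : ℤ) := by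
        push_cast
        ring
      have hval : -(-bbar * (((n + 1 : ℕ) : ℤ_[p]) • (abar * bbar ^ n))) + abar * bbar ^ (n + 1)
          = ((n + 1 + 1 : ℕ) : ℤ_[p]) • (abar * bbar ^ (n + 1)) := by
        have hmul : bbar * (abar * bbar ^ n) = abar * bbar ^ (n + 1) := by
          rw [← mul_assoc, hab, mul_assoc, ← pow_succ']
        rw [neg_mul, neg_neg, mul_smul_comm, hmul, Nat.cast_succ (n + 1), add_smul, one_smul]
      rwa [hdeg, hval] at hmassey
  intro i hi
  obtain ⟨n, rfl⟩ := Nat.exists_eq_add_of_le' hi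
  rw [Nat.add_sub_cancel]
  have hne : -((n + 1 : ℕ) : ℤ) ≠ 0 := by omega
  have hiso : Nonempty (D.H ((2 * (p : ℤ) - 2) * (-((n + 1 : ℕ) : ℤ)) - 1) ≃ₗ[ℤ_[p]]
      (ℤ_[p] ⧸ Ideal.span {((n + 1 : ℕ) : ℤ_[p]) * (p : ℤ_[p])})) := by
    have h := hH.2.2.1 _ hne
    rwa [Int.cast_neg, Int.cast_natCast, neg_mul, Ideal.span_singleton_neg] at h
  refine ⟨D.d_pow_succ hk hbbar hab hdbbar n, hcyc n, hcls n, ?_, hiso⟩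
  obtain ⟨e⟩ := hiso
  obtain ⟨h', hα⟩ := hcls n
  apply PadicInt.span_singleton_eq_top_of_smul_ne_zero e
  rw [← D.cls_smul _ (hcyc n) h', hα]
  exact (hord _ hne).1
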